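/- For every natural number n, the series Σ_{r : 2r ≥ n} binomial(2r, n) · ξ_r converges absolutely, and for every s ∈ ℂ, ξ(s − 1/2) = Σ_{n=0}^∞ (−1)^n · (Σ_{r : 2r ≥ n} binomial(2r, n) · ξ_r) · s^n. -/

import Mathlib

open Complex

/-- The Riemann xi function: `ξ(s) = (s(s-1)/2)·Λ₀(s) + 1/2`. -/
noncomputable def xi (s : ℂ) : ℂ := s * (s - 1) / 2 * completedRiemannZeta₀ s + 1 / 2

/-- `ξ_r = ξ^{(2r)}(1/2) / (2r)!`. -/
noncomputable def xiCoeff (r : ℕ) : ℂ := iteratedDeriv (2 * r) xi (1 / 2) / ((2 * r).factorial : ℂ)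

/-- `ξ₊(s) = (1/2)(ξ(s+1/2) + ξ(s−1/2))`. -/
noncomputable def xiPlus (s : ℂ) : ℂ := (1 / 2) * (xi (s + 1 / 2) + xi (s - 1 / 2))

/-- `ξ₋(s) = (1/2)(ξ(s+1/2) − ξ(s−1/2))`. -/
noncomputable def xiMinus (s : ℂ) : ℂ := (1 / 2) * (xi (s + 1 / 2) - xi (s - 1 / 2))

lemma differentiable_xi : Differentiable ℂ xi := by
  have h := differentiable_completedZeta₀
  unfold xi
  fun_prop

lemma xi_one_sub (s : ℂ) : xi (1 - s) = xi s := by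
  simp only [xi, completedRiemannZeta₀_one_sub]
  ring

lemma iteratedDeriv_xi_half_of_odd {n : ℕ} (hn : Odd n) : iteratedDeriv n xi (1 / 2) = 0 := by
  have h := congrFun (iteratedDeriv_comp_const_sub n xi (1 : ℂ)) (1 / 2)
  rw [funext xi_one_sub, hn.neg_one_pow] at h
  norm_num at h
  have h2 : (2 : ℂ) * iteratedDeriv n xi (1 / 2) = 0 := by
    linear_combination h
  simpa using h2

/-- The Taylor expansion of `xi` about `1 / 2` has only even terms. -/
lemma hasSum_xiCoeff (z : ℂ) :
    HasSum (fun r : ℕ => xiCoeff r * z ^ (2 * r)) (xi (1 / 2 + z)) := by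
  have h := hasSum_taylorSeries_of_entire differentiable_xi (1 / 2) (1 / 2 + z)
  have hinj : Function.Injective (fun r : ℕ => 2 * r) := fun a b hab => by simpa using hab
  rw [← hinj.hasSum_iff] at h
  · refine h.congr_fun fun r => ?_
    simp only [Function.comp, xiCoeff, smul_eq_mul, add_sub_cancel_left]
    ring
  · intro n hn
    have hodd : Odd n := by
      rw [← Nat.not_even_iff_odd, even_iff_exists_two_mul]
      rintro ⟨r, rfl⟩
      exact hn ⟨r, rfl⟩
    simp [iteratedDeriv_xi_half_of_odd hodd, - one_div]

lemma hasSum_choose_mul_pow {R : Type*} [CommSemiring R] [TopologicalSpace R] (m : ℕ) (x : R) :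
    HasSum (fun n : ℕ => (m.choose n : R) * x ^ n) ((1 + x) ^ m) := by
  have h : (1 + x) ^ m = ∑ n ∈ Finset.range (m + 1), (m.choose n : R) * x ^ n := by
    rw [add_comm, add_pow]
    exact Finset.sum_congr rfl fun n _ => by ring
  rw [h]
  refine hasSum_sum_of_ne_finset_zero fun n hn => ?_
  rw [Nat.choose_eq_zero_of_lt (by simpa [Nat.lt_succ_iff] using hn)]
  simp

lemma summable_xiCoeff_binomial (x : ℂ) :
    Summable (fun p : ℕ × ℕ => xiCoeff p.1 * (((2 * p.1).choose p.2 : ℂ) * x ^ p.2)) := by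
  have h (r : ℕ) : HasSum (fun n : ℕ => ‖xiCoeff r * (((2 * r).choose n : ℂ) * x ^ n)‖)
      (‖xiCoeff r‖ * (1 + ‖x‖) ^ (2 * r)) := by
    simpa using (hasSum_choose_mul_pow (2 * r) ‖x‖).mul_left ‖xiCoeff r‖
  refine Summable.of_norm ((summable_prod_of_nonneg fun _ => norm_nonneg _).2
    ⟨fun r => (h r).summable, ?_⟩)
  refine (hasSum_xiCoeff ((1 + ‖x‖ : ℝ) : ℂ)).summable.norm.congr fun r => ?_
  rw [(h r).tsum_eq, norm_mul, norm_pow, norm_real, Real.norm_of_nonneg (by positivity)]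

/-- Equation (16): for each `n` the series `Σ_{r : 2r ≥ n} C(2r,n) ξ_r` converges
absolutely (note `C(2r,n) = 0` when `2r < n`), and
`ξ(s − 1/2) = Σ_n (−1)^n (Σ_{r : 2r ≥ n} C(2r,n) ξ_r) s^n`. -/
theorem xi_shift_expansion :
    (∀ n : ℕ, Summable (fun r : ℕ => ‖((2 * r).choose n : ℂ) * xiCoeff r‖)) ∧
    (∀ s : ℂ, HasSum
      (fun n : ℕ => (-1) ^ n * (∑' r : ℕ, ((2 * r).choose n : ℂ) * xiCoeff r) * s ^ n)
      (xi (s - 1 / 2))) := by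
  refine ⟨fun n => ?_, fun s => ?_⟩
  · refine ((summable_xiCoeff_binomial 1).prod_symm.prod_factor n).norm.congr fun r => ?_
    simp [mul_comm]
  · have hs := summable_xiCoeff_binomial (-s)
    have h1 := hs.hasSum.prod_fiberwise fun r =>
      (hasSum_choose_mul_pow (2 * r) (-s)).mul_left (xiCoeff r)
    have h2 := hasSum_xiCoeff (1 + -s)
    have hxi : xi (1 / 2 + (1 + -s)) = xi (s - 1 / 2) := by
      rw [← xi_one_sub]
      ring_nf
    have h3 := hs.prod_symm.hasSum.prod_fiberwise fun n => (hs.prod_symm.prod_factor n).hasSum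
    have h4 := (Equiv.prodComm ℕ ℕ).tsum_eq
      fun p : ℕ × ℕ => xiCoeff p.1 * (((2 * p.1).choose p.2 : ℂ) * (-s) ^ p.2)
    simp only [Equiv.prodComm_apply] at h4
    rw [h4, h1.unique h2, hxi] at h3
    refine h3.congr_fun fun n => ?_
    simp only [Prod.fst_swap, Prod.snd_swap]
    rw [mul_right_comm, ← mul_pow, neg_one_mul, ← tsum_mul_left]
    exact tsum_congr fun r => by ring
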